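/- arXiv:math-ph/0602039 — 2 statements merged into one kernel-verified Lean document; each statement's English description precedes it below -/
import Mathlib

section
/- Let N ≥ 1 and let γ_Gin be the complex Ginibre probability measure on N×N complex matrices. Then for all a, b ∈ ℂ, ∫ Per(a·1_N − Z) · conj( Per(b·1_N − Z) ) dγ_Gin(Z) = (N!/N^N) · Σ_{k=0}^N (N·a·b̄)^k / k!. -/
open MeasureTheory Matrix Finset

instance matMS {m n : Type*} {α : Type*} [MeasurableSpace α] : MeasurableSpace (Matrix m n α) :=
  inferInstanceAs (MeasurableSpace (m → n → α))

/-- The permanent of a square complex matrix. -/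
noncomputable def perm {ι : Type*} [Fintype ι] [DecidableEq ι] (M : Matrix ι ι ℂ) : ℂ :=
  ∑ σ : Equiv.Perm ι, ∏ i, M i (σ i)

/-- The complex matrix built from real coordinates `(Re Z_ij, Im Z_ij)`. -/
noncomputable def matOf (m : ℕ) (x : Fin m × Fin m → ℝ × ℝ) : Matrix (Fin m) (Fin m) ℂ :=
  fun i j => ((x (i, j)).1 : ℂ) + ((x (i, j)).2 : ℂ) * Complex.I

/-- The Ginibre-type probability measure on `m × m` complex matrices with density
`(N/π)^{m²} exp(-N Σ_{ij} |Z_ij|²) = (N/π)^{m²} exp(-N Tr(Z* Z))` with respect to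
Lebesgue measure in the coordinates `(Re Z_ij, Im Z_ij)`.  For `m = N` this is the
complex Ginibre ensemble. -/
noncomputable def ginibre (N m : ℕ) : Measure (Matrix (Fin m) (Fin m) ℂ) :=
  Measure.map (matOf m) (volume.withDensity fun x =>
    ENNReal.ofReal (((N : ℝ) / Real.pi) ^ (m ^ 2) *
      Real.exp (-(N : ℝ) * ∑ p : Fin m × Fin m, ((x p).1 ^ 2 + (x p).2 ^ 2))))

/-- There are `(n - #t)!` permutations of an `n`-element type fixing a set `t` pointwise. -/
lemma card_perm_fixing {ι : Type*} [Fintype ι] [DecidableEq ι] (t : Finset ι) :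
    #{σ : Equiv.Perm ι | ∀ i ∈ t, σ i = i} = (Fintype.card ι - #t).factorial := by
  have h := Fintype.card_congr (Equiv.Perm.subtypeEquivSubtypePerm (fun i : ι => i ∉ t))
  rw [Fintype.card_perm, Fintype.card_subtype_compl, Fintype.card_coe, Fintype.card_subtype] at h
  rw [h]
  simp

/-- The permanent of the matrix with diagonal entries `c + d` and off-diagonal entries `d`. -/
lemma sum_perm_prod_diag_add_const {ι : Type*} [Fintype ι] [DecidableEq ι] (c d : ℂ) :
    ∑ σ : Equiv.Perm ι, ∏ i, ((if σ i = i then c else 0) + d) =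
      ∑ k ∈ range (Fintype.card ι + 1), (Fintype.card ι).choose k •
        (((Fintype.card ι - k).factorial : ℂ) * (c ^ k * d ^ (Fintype.card ι - k))) := by
  have h := Finset.sum_powerset_apply_card (fun k => ((Fintype.card ι - k).factorial : ℂ) *
    (c ^ k * d ^ (Fintype.card ι - k))) (x := (univ : Finset ι))
  rw [card_univ] at h
  rw [← h]
  simp_rw [prod_add]
  rw [sum_comm]
  refine sum_congr rfl fun t _ => ?_
  have hσ (σ : Equiv.Perm ι) : (∏ i ∈ t, if σ i = i then c else 0) * ∏ i ∈ univ \ t, d =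
      if ∀ i ∈ t, σ i = i then c ^ #t * d ^ (Fintype.card ι - #t) else 0 := by
    rw [prod_ite_zero, prod_const, prod_const, card_univ_sdiff, ite_mul, zero_mul]
    congr 1
  simp_rw [hσ]
  rw [← sum_filter, sum_const, card_perm_fixing, nsmul_eq_mul]

/-- The density of a centred complex Gaussian variable `z` with `E|z|² = 1 / N`. -/
noncomputable def complexGaussianDensity (N : ℕ) (z : ℝ × ℝ) : ℝ :=
  (N : ℝ) / Real.pi * Real.exp (-(N : ℝ) * (z.1 ^ 2 + z.2 ^ 2))

lemma continuous_complexGaussianDensity (N : ℕ) : Continuous (complexGaussianDensity N) := by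
  unfold complexGaussianDensity
  fun_prop

lemma complexGaussianDensity_nonneg (N : ℕ) (z : ℝ × ℝ) : 0 ≤ complexGaussianDensity N z := by
  unfold complexGaussianDensity
  positivity

lemma ofReal_gaussian_prod_eq_withDensity (N : ℕ) (hN : 1 ≤ N) {v : NNReal}
    (hv : (v : ℝ) = 1 / (2 * N)) :
    (ProbabilityTheory.gaussianReal 0 v).prod (ProbabilityTheory.gaussianReal 0 v) =
      volume.withDensity fun z => ENNReal.ofReal (complexGaussianDensity N z) := by
  have hN' : (0 : ℝ) < N := by exact_mod_cast hN
  have hv0 : v ≠ 0 := by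
    rintro rfl
    have : (0 : ℝ) < 1 / (2 * N) := by positivity
    simp [← hv] at this
  rw [ProbabilityTheory.gaussianReal_of_var_ne_zero 0 hv0,
    prod_withDensity (ProbabilityTheory.measurable_gaussianPDF _ _)
      (ProbabilityTheory.measurable_gaussianPDF _ _), ← Measure.volume_eq_prod]
  congr 1
  ext z
  simp only [ProbabilityTheory.gaussianPDF]
  rw [← ENNReal.ofReal_mul (ProbabilityTheory.gaussianPDFReal_nonneg _ _ _)]
  congr 1
  simp only [ProbabilityTheory.gaussianPDFReal, complexGaussianDensity, hv]
  have hs : (√(2 * Real.pi * (1 / (2 * N))))⁻¹ * (√(2 * Real.pi * (1 / (2 * N))))⁻¹ =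
      (N : ℝ) / Real.pi := by
    rw [← mul_inv, Real.mul_self_sqrt (by positivity)]
    field_simp
  rw [mul_mul_mul_comm, hs, ← Real.exp_add]
  congr 2
  field_simp
  ring

/-- Integrability and integral of a quadratic polynomial against the density of a centred
complex Gaussian variable. -/
lemma integral_complexGaussianDensity_mul_quadratic (N : ℕ) (hN : 1 ≤ N) (c₀ c₁ c₂ c₃ : ℂ) :
    Integrable (fun z : ℝ × ℝ => (complexGaussianDensity N z : ℂ) *
        (c₀ + c₁ * z.1 + c₂ * z.2 + c₃ * ((z.1 : ℂ) ^ 2 + (z.2 : ℂ) ^ 2))) ∧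
      ∫ z : ℝ × ℝ, (complexGaussianDensity N z : ℂ) *
        (c₀ + c₁ * z.1 + c₂ * z.2 + c₃ * ((z.1 : ℂ) ^ 2 + (z.2 : ℂ) ^ 2)) = c₀ + c₃ / N := by
  have hN' : (0 : ℝ) < N := by exact_mod_cast hN
  obtain ⟨v, hv⟩ : ∃ v : NNReal, (v : ℝ) = 1 / (2 * N) := ⟨⟨1 / (2 * N), by positivity⟩, rfl⟩
  have hP := ofReal_gaussian_prod_eq_withDensity N hN hv
  set ν := ProbabilityTheory.gaussianReal 0 v with hν
  have hm : Measurable fun z => ENNReal.ofReal (complexGaussianDensity N z) :=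
    (continuous_complexGaussianDensity N).measurable.ennreal_ofReal
  have hL : MemLp id 2 ν := ProbabilityTheory.memLp_id_gaussianReal 2
  have i1 : Integrable (fun x : ℝ => (x : ℂ)) ν := (hL.integrable one_le_two).ofReal
  have i2 : Integrable (fun x : ℝ => (x : ℂ) ^ 2) ν := by
    simpa using (hL.integrable_sq).ofReal (𝕜 := ℂ)
  have e1 : ∫ x : ℝ, (x : ℂ) ∂ν = 0 := by
    rw [integral_complex_ofReal, hν, ProbabilityTheory.integral_id_gaussianReal]; simp
  have e2 : ∫ x : ℝ, (x : ℂ) ^ 2 ∂ν = v := by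
    have h := ProbabilityTheory.variance_eq_sub hL
    rw [hν, ProbabilityTheory.variance_id_gaussianReal] at h
    simp only [id, Pi.pow_apply, ProbabilityTheory.integral_id_gaussianReal] at h
    simp_rw [← Complex.ofReal_pow]
    rw [integral_complex_ofReal, hν]
    simp [h]
  have j1 : Integrable (fun z : ℝ × ℝ => c₁ * (z.1 : ℂ)) (ν.prod ν) := (i1.comp_fst ν).const_mul _
  have j2 : Integrable (fun z : ℝ × ℝ => c₂ * (z.2 : ℂ)) (ν.prod ν) := (i1.comp_snd ν).const_mul _
  have j3 : Integrable (fun z : ℝ × ℝ => (z.1 : ℂ) ^ 2) (ν.prod ν) := i2.comp_fst ν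
  have j4 : Integrable (fun z : ℝ × ℝ => (z.2 : ℂ) ^ 2) (ν.prod ν) := i2.comp_snd ν
  have j0 : Integrable (fun _ : ℝ × ℝ => c₀) (ν.prod ν) := integrable_const _
  have j01 : Integrable (fun z : ℝ × ℝ => c₀ + c₁ * (z.1 : ℂ)) (ν.prod ν) := j0.add j1
  have j012 : Integrable (fun z : ℝ × ℝ => c₀ + c₁ * (z.1 : ℂ) + c₂ * (z.2 : ℂ)) (ν.prod ν) :=
    j01.add j2
  have j34 : Integrable (fun z : ℝ × ℝ => c₃ * ((z.1 : ℂ) ^ 2 + (z.2 : ℂ) ^ 2)) (ν.prod ν) :=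
    (j3.add j4).const_mul c₃
  have hq : Integrable (fun z : ℝ × ℝ => c₀ + c₁ * z.1 + c₂ * z.2 +
      c₃ * ((z.1 : ℂ) ^ 2 + (z.2 : ℂ) ^ 2)) (ν.prod ν) :=
    j012.add j34
  have hI : ∫ z : ℝ × ℝ, (c₀ + c₁ * z.1 + c₂ * z.2 +
      c₃ * ((z.1 : ℂ) ^ 2 + (z.2 : ℂ) ^ 2)) ∂(ν.prod ν) = c₀ + c₃ / N := by
    rw [integral_add j012 j34, integral_add j01 j2,
      integral_add j0 j1, integral_const_mul, integral_const_mul, integral_const_mul,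
      integral_add j3 j4, integral_fun_fst (μ := ν) (ν := ν) (fun x : ℝ => (x : ℂ)),
      integral_fun_snd (μ := ν) (ν := ν) (fun x : ℝ => (x : ℂ)),
      integral_fun_fst (μ := ν) (ν := ν) (fun x : ℝ => (x : ℂ) ^ 2),
      integral_fun_snd (μ := ν) (ν := ν) (fun x : ℝ => (x : ℂ) ^ 2), e1, e2]
    have hv' : (v : ℂ) = 1 / (2 * N) := by simpa using congrArg Complex.ofReal hv
    have : (N : ℂ) ≠ 0 := by exact_mod_cast hN'.ne'
    simp [hv']
    field_simp
    norm_num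
  rw [hP] at hq hI
  rw [integrable_withDensity_iff_integrable_smul' hm (by simp)] at hq
  rw [integral_withDensity_eq_integral_toReal_smul hm (by simp)] at hI
  simp only [ENNReal.toReal_ofReal (complexGaussianDensity_nonneg N _), Complex.real_smul] at hq hI
  exact ⟨hq, hI⟩

/-- The factor contributed by one matrix entry, with real coordinates `z` and mean values `α`
and `β` in the two matrices, to a product of two permanents; `p` and `q` say whether the entry
occurs in the respective permutation. -/
noncomputable def entryFactor (p q : Prop) [Decidable p] [Decidable q] (α β : ℂ) (z : ℝ × ℝ) : ℂ :=
  (if p then α - (z.1 + z.2 * Complex.I) else 1) *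
    (starRingEnd ℂ) (if q then β - (z.1 + z.2 * Complex.I) else 1)

lemma integral_density_mul_entryFactor (N : ℕ) (hN : 1 ≤ N) (p q : Prop) [Decidable p]
    [Decidable q] (α β : ℂ) :
    Integrable (fun z => (complexGaussianDensity N z : ℂ) * entryFactor p q α β z) ∧
      ∫ z, (complexGaussianDensity N z : ℂ) * entryFactor p q α β z =
        (if p then α else 1) * (starRingEnd ℂ) (if q then β else 1) +
          if p ∧ q then 1 / (N : ℂ) else 0 := by
  have key (c₀ c₁ c₂ c₃ : ℂ) (h : ∀ z : ℝ × ℝ, entryFactor p q α β z =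
      c₀ + c₁ * z.1 + c₂ * z.2 + c₃ * ((z.1 : ℂ) ^ 2 + (z.2 : ℂ) ^ 2)) :
      Integrable (fun z => (complexGaussianDensity N z : ℂ) * entryFactor p q α β z) ∧
      ∫ z, (complexGaussianDensity N z : ℂ) * entryFactor p q α β z = c₀ + c₃ / N := by
    simp_rw [h]
    exact integral_complexGaussianDensity_mul_quadratic N hN c₀ c₁ c₂ c₃
  by_cases hp : p <;> by_cases hq : q
  · convert! key (α * (starRingEnd ℂ) β) (-α - (starRingEnd ℂ) β)
      (α * Complex.I - (starRingEnd ℂ) β * Complex.I) 1 ?_ using 2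
    · simp [hp, hq]
    · intro z
      simp only [entryFactor, hp, hq, if_true, map_sub, map_add, map_mul, Complex.conj_ofReal,
        Complex.conj_I]
      linear_combination (-(z.2 : ℂ) ^ 2) * Complex.I_sq
  · convert! key α (-1) (-Complex.I) 0 ?_ using 2
    · simp [hp, hq]
    · intro z
      simp only [entryFactor, hp, hq, if_true, if_false, map_one]
      ring
  · convert! key ((starRingEnd ℂ) β) (-1) Complex.I 0 ?_ using 2
    · simp [hp, hq]
    · intro z
      simp only [entryFactor, hp, hq, if_true, if_false, map_sub, map_add, map_mul,
        Complex.conj_ofReal, Complex.conj_I]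
      ring
  · convert! key 1 0 0 0 ?_ using 2
    · simp [hp, hq]
    · intro z
      simp [entryFactor, hp, hq]

/-- A product over the graph of a map, as a product over all pairs. -/
lemma prod_graph {ι R : Type*} [Fintype ι] [DecidableEq ι] [CommMonoid R] (σ : ι → ι)
    (g : ι × ι → R) : ∏ i, g (i, σ i) = ∏ p : ι × ι, if σ p.1 = p.2 then g p else 1 := by
  rw [Fintype.prod_prod_type]
  simp

lemma measurable_matOf (m : ℕ) : Measurable (matOf m) := by
  refine measurable_pi_lambda _ fun i => measurable_pi_lambda _ fun j => ?_
  unfold matOf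
  fun_prop

lemma Measurable.perm {X ι : Type*} [MeasurableSpace X] [Fintype ι] [DecidableEq ι]
    {f : X → Matrix ι ι ℂ} (hf : ∀ i j, Measurable fun x => f x i j) :
    Measurable fun x => _root_.perm (f x) :=
  Finset.measurable_fun_sum _ fun σ _ => Finset.measurable_fun_prod _ fun i _ => hf i (σ i)

/-- Integration against the Ginibre measure in real coordinates. -/
lemma integral_ginibre (N m : ℕ) {F : Matrix (Fin m) (Fin m) ℂ → ℂ} (hF : Measurable F) :
    ∫ Z, F Z ∂(ginibre N m) = ∫ x : Fin m × Fin m → ℝ × ℝ,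
      (∏ p, (complexGaussianDensity N (x p) : ℂ)) * F (matOf m x) := by
  rw [ginibre, integral_map (measurable_matOf m).aemeasurable hF.aestronglyMeasurable,
    integral_withDensity_eq_integral_toReal_smul (by fun_prop) (by simp)]
  congr 1
  ext x
  rw [ENNReal.toReal_ofReal (by positivity), Complex.real_smul, ← Complex.ofReal_prod]
  congr 2
  simp only [complexGaussianDensity]
  rw [prod_mul_distrib, prod_const, card_univ, Fintype.card_prod, Fintype.card_fin, ← Real.exp_sum,
    mul_sum, sq m]

/-- The expectation of the contribution of a pair of permutations to the two-point function. -/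
lemma prod_integral_entryFactor {ι : Type*} [Fintype ι] [DecidableEq ι] (N : ℕ) (hN : 1 ≤ N)
    (a b : ℂ) (σ τ : Equiv.Perm ι) :
    ∏ p : ι × ι, ∫ z, (complexGaussianDensity N z : ℂ) *
        entryFactor (σ p.1 = p.2) (τ p.1 = p.2) ((a • (1 : Matrix ι ι ℂ)) p.1 p.2)
          ((b • (1 : Matrix ι ι ℂ)) p.1 p.2) z =
      if σ = τ then ∏ i, ((if σ i = i then a * (starRingEnd ℂ) b else 0) + 1 / (N : ℂ)) else 0 := by
  simp_rw [(integral_density_mul_entryFactor N hN _ _ _ _).2]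
  rw [Fintype.prod_prod_type]
  split_ifs with h
  · subst h
    refine prod_congr rfl fun i _ => ?_
    rw [prod_eq_single (σ i)]
    · by_cases hi : σ i = i
      · simp [hi]
      · simp [hi, Ne.symm hi]
    · intro j _ hj
      simp [hj.symm]
    · simp
  · obtain ⟨i, hi⟩ : ∃ i, σ i ≠ τ i := by
      by_contra! hc
      exact h (Equiv.ext hc)
    refine prod_eq_zero (mem_univ i) ?_
    by_cases hσ : σ i = i
    · refine prod_eq_zero (mem_univ (τ i)) ?_
      have : i ≠ τ i := fun h => hi (hσ.trans h)
      simp [hi, this]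
    · refine prod_eq_zero (mem_univ (σ i)) ?_
      simp [Ne.symm hi, Ne.symm hσ]

/-- Two-point correlation function of Ginibre permanental polynomials:
`⟨Per(a·1-Z) conj(Per(b·1-Z))⟩_Gin = (N!/N^N) Σ_{k=0}^N (N a b̄)^k / k!`. -/
theorem ginibre_two_point_correlation (N : ℕ) (hN : 1 ≤ N) (a b : ℂ) :
    (∫ Z, perm (a • (1 : Matrix (Fin N) (Fin N) ℂ) - Z) *
        (starRingEnd ℂ) (perm (b • (1 : Matrix (Fin N) (Fin N) ℂ) - Z)) ∂(ginibre N N))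
      = ((N.factorial : ℂ) / (N : ℂ) ^ N) *
          ∑ k ∈ Finset.range (N + 1),
            ((N : ℂ) * a * (starRingEnd ℂ) b) ^ k / (k.factorial : ℂ) := by
  have hmeas (c : ℂ) : Measurable fun Z : Matrix (Fin N) (Fin N) ℂ =>
      perm (c • (1 : Matrix (Fin N) (Fin N) ℂ) - Z) :=
    Measurable.perm fun i j => measurable_const.sub
      ((measurable_pi_apply j).comp (measurable_pi_apply i))
  have hexp (x : Fin N × Fin N → ℝ × ℝ) :
      (∏ p, (complexGaussianDensity N (x p) : ℂ)) *
        (perm (a • (1 : Matrix (Fin N) (Fin N) ℂ) - matOf N x) *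
          (starRingEnd ℂ) (perm (b • (1 : Matrix (Fin N) (Fin N) ℂ) - matOf N x))) =
      ∑ σ : Equiv.Perm (Fin N), ∑ τ : Equiv.Perm (Fin N), ∏ p : Fin N × Fin N,
        ((complexGaussianDensity N (x p) : ℂ) *
          entryFactor (σ p.1 = p.2) (τ p.1 = p.2) ((a • (1 : Matrix (Fin N) (Fin N) ℂ)) p.1 p.2)
            ((b • (1 : Matrix (Fin N) (Fin N) ℂ)) p.1 p.2) (x p)) := by
    rw [perm, perm, map_sum, sum_mul_sum, mul_sum]
    refine sum_congr rfl fun σ _ => ?_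
    rw [mul_sum]
    refine sum_congr rfl fun τ _ => ?_
    rw [prod_mul_distrib]
    congr 1
    simp only [entryFactor]
    rw [prod_mul_distrib, ← map_prod]
    congr 1
    · exact prod_graph σ fun p => (a • (1 : Matrix (Fin N) (Fin N) ℂ) - matOf N x) p.1 p.2
    · congr 1
      exact prod_graph τ fun p => (b • (1 : Matrix (Fin N) (Fin N) ℂ) - matOf N x) p.1 p.2
  have hint (σ τ : Equiv.Perm (Fin N)) : Integrable fun x : Fin N × Fin N → ℝ × ℝ =>
      ∏ p : Fin N × Fin N, ((complexGaussianDensity N (x p) : ℂ) *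
          entryFactor (σ p.1 = p.2) (τ p.1 = p.2) ((a • (1 : Matrix (Fin N) (Fin N) ℂ)) p.1 p.2)
            ((b • (1 : Matrix (Fin N) (Fin N) ℂ)) p.1 p.2) (x p)) :=
    Integrable.fintype_prod (μ := fun _ => volume)
      (f := fun (p : Fin N × Fin N) z => (complexGaussianDensity N z : ℂ) *
          entryFactor (σ p.1 = p.2) (τ p.1 = p.2) ((a • (1 : Matrix (Fin N) (Fin N) ℂ)) p.1 p.2)
            ((b • (1 : Matrix (Fin N) (Fin N) ℂ)) p.1 p.2) z)
      fun p => (integral_density_mul_entryFactor N hN _ _ _ _).1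
  rw [integral_ginibre N N (F := fun Z => perm (a • (1 : Matrix (Fin N) (Fin N) ℂ) - Z) *
    (starRingEnd ℂ) (perm (b • (1 : Matrix (Fin N) (Fin N) ℂ) - Z))) ((hmeas a).mul (Complex.continuous_conj.measurable.comp (hmeas b)))]
  simp_rw [hexp]
  rw [integral_finsetSum _ fun σ _ => integrable_finsetSum _ fun τ _ => hint σ τ]
  have hσ (σ : Equiv.Perm (Fin N)) := integral_finsetSum univ fun τ _ => hint σ τ
  simp_rw [hσ]
  have hστ (σ τ : Equiv.Perm (Fin N)) :=
    (integral_fintype_prod_volume_eq_prod (fun (p : Fin N × Fin N) (z : ℝ × ℝ) =>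
      (complexGaussianDensity N z : ℂ) *
          entryFactor (σ p.1 = p.2) (τ p.1 = p.2) ((a • (1 : Matrix (Fin N) (Fin N) ℂ)) p.1 p.2)
            ((b • (1 : Matrix (Fin N) (Fin N) ℂ)) p.1 p.2) z)).trans
      (prod_integral_entryFactor N hN a b σ τ)
  simp_rw [hστ]
  simp only [sum_ite_eq, mem_univ, if_true]
  rw [sum_perm_prod_diag_add_const, Fintype.card_fin, mul_sum]
  refine sum_congr rfl fun k hk => ?_
  have hkN : k ≤ N := Nat.lt_succ_iff.mp (mem_range.mp hk)
  have hN0 : (N : ℂ) ≠ 0 := by exact_mod_cast (by omega : N ≠ 0)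
  have hk0 : (k.factorial : ℂ) ≠ 0 := by exact_mod_cast k.factorial_ne_zero
  have hfac : (N.choose k : ℂ) * k.factorial * (N - k).factorial = N.factorial := by
    exact_mod_cast Nat.choose_mul_factorial_mul_factorial hkN
  have hpow : (N : ℂ) ^ N = (N : ℂ) ^ k * (N : ℂ) ^ (N - k) := by
    rw [← pow_add, Nat.add_sub_cancel' hkN]
  rw [← hfac, hpow, nsmul_eq_mul, mul_assoc (N : ℂ) a, mul_pow (N : ℂ), one_div, inv_pow]
  field_simp
end

section
/- Let N ≥ 1 and let γ_GOE be the GOE probability measure on N×N real symmetric matrices. Then for all μ_1, μ_2 ∈ ℂ, the two-point correlation function of GOE permanental polynomials equals the corresponding correlation function of characteristic polynomials at rotated arguments: ∫ Per(μ_1·1_N − H) · Per(μ_2·1_N − H) dγ_GOE(H) = ∫ det(iμ_1·1_N − H) · det(−iμ_2·1_N − H) dγ_GOE(H). -/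
open MeasureTheory Matrix Finset Polynomial

/-- The real symmetric matrix built from the coordinates: diagonal entries `x.1 i` and
off-diagonal entries `H_ij = H_ji = x.2 ⟨(i,j), _⟩` for `i < j`. -/
noncomputable def symOf (N : ℕ)
    (x : (Fin N → ℝ) × ({p : Fin N × Fin N // p.1 < p.2} → ℝ)) :
    Matrix (Fin N) (Fin N) ℝ := fun i j =>
  if h : i < j then x.2 ⟨(i, j), h⟩
  else if h' : j < i then x.2 ⟨(j, i), h'⟩
  else x.1 i

/-- The GOE probability measure on `N × N` real symmetric matrices with density
`2^{-N/2} (N/π)^{N(N+1)/4} exp(-(N/2) Tr H²)` with respect to Lebesgue measure in the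
coordinates `(H_ii)_i, (H_ij)_{i<j}`. -/
noncomputable def goe (N : ℕ) : Measure (Matrix (Fin N) (Fin N) ℝ) :=
  Measure.map (symOf N) (volume.withDensity fun x =>
    ENNReal.ofReal ((2 : ℝ) ^ (-(N : ℝ) / 2) * ((N : ℝ) / Real.pi) ^ ((N : ℝ) * (N + 1) / 4) *
      Real.exp (-(N : ℝ) / 2 * Matrix.trace (symOf N x ^ 2))))

section
open Complex

/-- The product of the signs of `σ` and `τ`, with a factor `I` for each fixed point of `σ` and a
factor `-I` for each fixed point of `τ`. -/
noncomputable def fixSign {α : Type*} [Fintype α] [DecidableEq α] (σ τ : Equiv.Perm α) : ℂ :=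
  ((Equiv.Perm.sign σ : ℤ) : ℂ) * ((Equiv.Perm.sign τ : ℤ) : ℂ) *
    ∏ i, (if σ i = i then I else 1) * (if τ i = i then -I else 1)

section
universe u
variable {α : Type u} [Fintype α] [DecidableEq α]

lemma sign_eq_mul_subtypePerm (σ : Equiv.Perm α) (p : α → Prop) [DecidablePred p]
    (h : ∀ x, p (σ x) ↔ p x) :
    Equiv.Perm.sign σ = Equiv.Perm.sign (σ.subtypePerm h) *
      Equiv.Perm.sign (σ.subtypePerm (p := fun x => ¬ p x) fun x => not_congr (h x)) := by
  rw [← Equiv.Perm.sign_subtypeCongr]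
  congr 1
  ext x
  by_cases hx : p x
  · rw [Equiv.Perm.subtypeCongr.left_apply _ _ hx]; rfl
  · rw [Equiv.Perm.subtypeCongr.right_apply _ _ hx]; rfl

lemma fixSign_eq_mul_subtypePerm (σ τ : Equiv.Perm α) (p : α → Prop) [DecidablePred p]
    (hσ : ∀ x, p (σ x) ↔ p x) (hτ : ∀ x, p (τ x) ↔ p x) :
    fixSign σ τ = fixSign (σ.subtypePerm hσ) (τ.subtypePerm hτ) *
      fixSign (σ.subtypePerm (p := fun x => ¬ p x) fun x => not_congr (hσ x))
        (τ.subtypePerm (p := fun x => ¬ p x) fun x => not_congr (hτ x)) := by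
  unfold fixSign
  rw [sign_eq_mul_subtypePerm σ p hσ, sign_eq_mul_subtypePerm τ p hτ,
    ← Fintype.prod_subtype_mul_prod_subtype p]
  simp only [Equiv.Perm.subtypePerm_apply, Subtype.ext_iff, Units.val_mul, Int.cast_mul]
  ring

lemma sign_mul_self_cast (σ : Equiv.Perm α) :
    ((Equiv.Perm.sign σ : ℤ) : ℂ) * ((Equiv.Perm.sign σ : ℤ) : ℂ) = 1 := by
  rcases Int.units_eq_one_or (Equiv.Perm.sign σ) with h | h <;> simp [h]

lemma fixSign_self (σ : Equiv.Perm α) : fixSign σ σ = 1 := by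
  rw [fixSign, sign_mul_self_cast, one_mul]
  refine prod_eq_one fun i _ => ?_
  split_ifs <;> simp

lemma fixSign_inv (σ : Equiv.Perm α) : fixSign σ σ⁻¹ = 1 := by
  rw [← fixSign_self σ]
  simp only [fixSign, Equiv.Perm.sign_inv, Equiv.Perm.inv_eq_iff_eq, eq_comm (b := σ _)]

lemma sign_mul_prod_fixed_of_sq_eq_one (z : ℂ) (hz : z ^ 2 = -1) {σ : Equiv.Perm α}
    (h : σ ^ 2 = 1) :
    ((Equiv.Perm.sign σ : ℤ) : ℂ) * ∏ i, (if σ i = i then z else 1) = z ^ Fintype.card α := by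
  have hc : ∏ i, (if σ i = i then z else 1) = z ^ Fintype.card (Function.fixedPoints σ) := by
    rw [← prod_filter, prod_const, Fintype.card_subtype]
    rfl
  have hle : Fintype.card (Function.fixedPoints σ) ≤ Fintype.card α :=
    Fintype.card_subtype_le _
  have hmod : Fintype.card (Function.fixedPoints σ) ≡ Fintype.card α [MOD 2] :=
    (Equiv.Perm.card_fixedPoints_modEq (p := 2) (n := 1) (f := (σ : α → α)) (by
      exact funext fun x => congrArg (fun g : Equiv.Perm α => g x) h)).symm
  obtain ⟨k, hk⟩ := (Nat.modEq_iff_dvd' hle).1 hmod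
  have hn : Fintype.card α = 2 * k + Fintype.card (Function.fixedPoints σ) := by omega
  rw [hc, Equiv.Perm.sign_of_pow_two_eq_one h, hk, Nat.mul_div_cancel_left _ two_pos, hn, pow_add,
    pow_mul, hz]
  push_cast
  ring

lemma fixSign_of_sq_eq_one {σ τ : Equiv.Perm α} (hσ : σ ^ 2 = 1) (hτ : τ ^ 2 = 1) :
    fixSign σ τ = 1 := by
  rw [fixSign, prod_mul_distrib, mul_mul_mul_comm, sign_mul_prod_fixed_of_sq_eq_one I I_sq hσ,
    sign_mul_prod_fixed_of_sq_eq_one (-I) (by simp) hτ, ← mul_pow]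
  simp

/-- The number of traversals of the edge between `i` and `j` by the cycles of `σ` and `τ`. -/
def edgeCount (σ τ : Equiv.Perm α) (i j : α) : ℕ :=
  ((if σ i = j then 1 else 0) + (if σ j = i then 1 else 0)) +
    ((if τ i = j then 1 else 0) + (if τ j = i then 1 else 0))

lemma fixSign_eq_one {σ τ : Equiv.Perm α} (h : ∀ i j, i ≠ j → Even (edgeCount σ τ i j)) :
    fixSign σ τ = 1 := by
  have inv_of_inv : ∀ {σ τ : Equiv.Perm α}, (∀ i j, i ≠ j → Even (edgeCount σ τ i j)) →
      ∀ i, σ (σ i) = i → τ (τ i) = i := by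
    intro σ τ h i hi
    by_contra hne
    have h1 := h i (τ i) (by grind)
    have h2 : σ i = τ i ↔ σ (τ i) = i :=
      ⟨fun e => e ▸ hi, fun e => σ.injective (by rw [hi, e])⟩
    by_cases h3 : σ i = τ i <;> simp_all [edgeCount]; revert h1; decide
  have h' : ∀ i j, i ≠ j → Even (edgeCount τ σ i j) := fun i j hij => by
    simpa [edgeCount, add_comm, add_left_comm] using h i j hij
  have inv_iff : ∀ i, σ (σ i) = i ↔ τ (τ i) = i := fun i =>
    ⟨inv_of_inv h i, inv_of_inv h' i⟩
  have step : ∀ i, σ (σ i) ≠ i → τ i = σ i ∨ σ (τ i) = i := by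
    intro i hi
    have hi' := (inv_iff i).not.1 hi
    have h1 := h i (τ i) (by grind)
    by_contra! hc
    simp [edgeCount, hc.2, hi', hc.1.symm] at h1
  rw [fixSign_eq_mul_subtypePerm σ τ (fun i => σ (σ i) = i) (fun x => by simp)
    (fun x => by simp [inv_iff]),
    fixSign_of_sq_eq_one (by exact Equiv.ext fun x => Subtype.ext x.2)
      (by exact Equiv.ext fun x => Subtype.ext ((inv_iff x).1 x.2)), one_mul]
  have fwd : ∀ i, σ (σ i) ≠ i → (τ (σ i) = σ (σ i) ↔ τ i = σ i) := by
    intro i hi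
    have hi' := (inv_iff i).not.1 hi
    constructor
    · intro e
      have h1 := h i (σ i) (by grind)
      by_contra hc
      simp [edgeCount, e, hi, hc] at h1
    · intro e
      rcases step (σ i) (by simpa using hi) with h2 | h2
      · exact h2
      · exact absurd (σ.injective h2) (e ▸ hi')
  have fwd' : ∀ i, σ (σ i) ≠ i → (τ (τ i) = σ (τ i) ↔ τ i = σ i) := by
    intro i hi
    rcases step i hi with h2 | h2
    · rw [h2]; simpa [h2] using fwd i hi
    · have h3 := fwd (τ i) (by rw [h2]; grind)
      rw [h2] at h3 ⊢
      exact h3.symm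
  rw [fixSign_eq_mul_subtypePerm _ _
    (fun i : {i // ¬ σ (σ i) = i} => τ i = σ i)
    (fun x => by simpa using fwd x x.2) (fun x => by simpa using fwd' x x.2)]
  have e1 : ∀ {β : Type u} [Fintype β] [DecidableEq β] {a b : Equiv.Perm β}, b = a →
      fixSign a b = 1 := by
    rintro β _ _ a b rfl; exact fixSign_self _
  have e2 : ∀ {β : Type u} [Fintype β] [DecidableEq β] {a b : Equiv.Perm β}, a * b = 1 →
      fixSign a b = 1 := by
    intro β _ _ a b hab
    rw [eq_inv_of_mul_eq_one_right hab]; exact fixSign_inv _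
  have back : ∀ x : {x : {i // ¬ σ (σ i) = i} // ¬ τ x = σ x}, σ (τ x) = x := fun x =>
    (step x.1 x.1.2).resolve_left x.2
  rw [e1 (by ext x; simpa using x.2),
    e2 (by exact Equiv.ext fun x => Subtype.ext <| Subtype.ext <| back x), one_mul]
end

section Gaussian

lemma integrable_pow_mul_gaussian {c : ℝ} (hc : 0 < c) (n : ℕ) :
    Integrable fun y : ℝ => (-(y : ℂ)) ^ n * (Real.exp (-c * y ^ 2) : ℂ) := by
  have h : Integrable fun y : ℝ => (-y) ^ n * Real.exp (-c * y ^ 2) := by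
    have := (integrable_rpow_mul_exp_neg_mul_sq hc (s := n)
      (by linarith [n.cast_nonneg (α := ℝ)])).const_mul ((-1) ^ n)
    simp only [Real.rpow_natCast] at this
    refine this.congr (.of_forall fun y => ?_)
    simp only [neg_pow y n, mul_assoc]
  simpa using h.ofReal (𝕜 := ℂ)

lemma integral_odd_pow_mul_gaussian (c : ℝ) {n : ℕ} (hn : ¬ Even n) :
    ∫ y : ℝ, (-(y : ℂ)) ^ n * (Real.exp (-c * y ^ 2) : ℂ) = 0 := by
  have h := integral_neg_eq_self (fun y : ℝ => (-(y : ℂ)) ^ n * (Real.exp (-c * y ^ 2) : ℂ)) volume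
  simp only [ofReal_neg, (Nat.not_even_iff_odd.1 hn).neg_pow, neg_sq, neg_mul, integral_neg,
    neg_neg] at h ⊢
  rw [self_eq_neg.1 h, neg_zero]

lemma integrable_shift_mul_gaussian {c : ℝ} (hc : 0 < c) (a b : ℂ) (p q : Prop) [Decidable p]
    [Decidable q] : Integrable fun h : ℝ =>
      ((if p then a - h else 1) * (if q then b - h else 1)) * (Real.exp (-c * h ^ 2) : ℂ) := by
  have h0 := integrable_pow_mul_gaussian hc 0
  have h1 := integrable_pow_mul_gaussian hc 1
  have h2 := integrable_pow_mul_gaussian hc 2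
  split_ifs
  · refine ((h2.add (h1.const_mul (a + b))).add (h0.const_mul (a * b))).congr
      (.of_forall fun y => ?_)
    simp only [Pi.add_apply]
    ring
  · refine (h1.add (h0.const_mul a)).congr (.of_forall fun y => ?_)
    simp only [Pi.add_apply]
    ring
  · refine (h1.add (h0.const_mul b)).congr (.of_forall fun y => ?_)
    simp only [Pi.add_apply]
    ring
  · simpa using h0

lemma integral_sub_mul_gaussian {c : ℝ} (hc : 0 < c) (a : ℂ) :
    ∫ h : ℝ, (a - h) * (Real.exp (-c * h ^ 2) : ℂ) = a * ∫ h : ℝ, (Real.exp (-c * h ^ 2) : ℂ) := by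
  have h0 := integrable_pow_mul_gaussian hc 0
  have h1 := integrable_pow_mul_gaussian hc 1
  have e1 := integral_odd_pow_mul_gaussian c (n := 1) (by decide)
  have := integral_add h1 (h0.const_mul a)
  rw [e1, integral_const_mul, zero_add] at this
  simp only [pow_zero, one_mul] at this
  rw [← this]
  congr 1 with y
  ring

lemma integral_sub_mul_sub_mul_gaussian {c : ℝ} (hc : 0 < c) (a b : ℂ) :
    ∫ h : ℝ, ((a - h) * (b - h)) * (Real.exp (-c * h ^ 2) : ℂ) =
      (∫ h : ℝ, (-(h : ℂ)) ^ 2 * (Real.exp (-c * h ^ 2) : ℂ)) +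
        a * b * ∫ h : ℝ, (Real.exp (-c * h ^ 2) : ℂ) := by
  have h0 := integrable_pow_mul_gaussian hc 0
  have h1 := integrable_pow_mul_gaussian hc 1
  have h2 := integrable_pow_mul_gaussian hc 2
  have e1 := integral_odd_pow_mul_gaussian c (n := 1) (by decide)
  have h3 := integral_add (h2.add (h1.const_mul (a + b))) (h0.const_mul (a * b))
  have h4 := integral_add h2 (h1.const_mul (a + b))
  simp only [Pi.add_apply] at h3
  rw [h4, integral_const_mul, e1, integral_const_mul, mul_zero, add_zero] at h3
  simp only [pow_zero, one_mul] at h3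
  rw [← h3]
  congr 1 with y
  ring

lemma integral_shift_rotate {c : ℝ} (hc : 0 < c) (a b : ℂ) (p q : Prop) [Decidable p]
    [Decidable q] :
    ∫ h : ℝ, ((if p then I * a - h else 1) * (if q then -I * b - h else 1)) *
        (Real.exp (-c * h ^ 2) : ℂ) =
      ((if p then I else 1) * (if q then -I else 1)) *
        ∫ h : ℝ, ((if p then a - h else 1) * (if q then b - h else 1)) *
          (Real.exp (-c * h ^ 2) : ℂ) := by
  split_ifs
  · rw [integral_sub_mul_sub_mul_gaussian hc, integral_sub_mul_sub_mul_gaussian hc]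
    linear_combination (∫ h : ℝ, (-(h : ℂ)) ^ 2 * (Real.exp (-c * h ^ 2) : ℂ)) * I_mul_I
  · simp only [mul_one]
    rw [integral_sub_mul_gaussian hc, integral_sub_mul_gaussian hc]
    ring
  · simp only [one_mul]
    rw [integral_sub_mul_gaussian hc, integral_sub_mul_gaussian hc]
    ring
  · simp

end Gaussian

section Coordinates
variable {N : ℕ}

lemma symOf_comm (x : (Fin N → ℝ) × ({p : Fin N × Fin N // p.1 < p.2} → ℝ)) (i j : Fin N) :
    symOf N x i j = symOf N x j i := by
  unfold symOf
  rcases lt_trichotomy i j with h | rfl | h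
  · simp [h, h.not_gt]
  · rfl
  · simp [h, h.not_gt]

lemma symOf_self (x : (Fin N → ℝ) × ({p : Fin N × Fin N // p.1 < p.2} → ℝ)) (i : Fin N) :
    symOf N x i i = x.1 i := by
  simp [symOf]

lemma symOf_of_lt (x : (Fin N → ℝ) × ({p : Fin N × Fin N // p.1 < p.2} → ℝ))
    (p : {p : Fin N × Fin N // p.1 < p.2}) : symOf N x p.1.1 p.1.2 = x.2 p := by
  simp [symOf, p.2]

lemma measurable_symOf : Measurable (symOf N) := by
  refine measurable_pi_lambda _ fun i => measurable_pi_lambda _ fun j => ?_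
  unfold symOf
  split_ifs <;> fun_prop

lemma trace_symOf_sq (x : (Fin N → ℝ) × ({p : Fin N × Fin N // p.1 < p.2} → ℝ)) :
    trace (symOf N x ^ 2) = ∑ i, x.1 i ^ 2 + 2 * ∑ p, x.2 p ^ 2 := by
  have hp : ∑ p, x.2 p ^ 2 = ∑ i, ∑ j, if i < j then symOf N x i j ^ 2 else 0 := by
    simp_rw [← symOf_of_lt x]
    rw [← Fintype.sum_prod_type', ← sum_filter,
      ← sum_subtype (univ.filter fun p : Fin N × Fin N => p.1 < p.2) (by simp)
        (fun p => symOf N x p.1 p.2 ^ 2)]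
  have hs : ∀ i j, symOf N x i j * symOf N x j i =
      (if i = j then x.1 i ^ 2 else 0) + ((if i < j then symOf N x i j ^ 2 else 0) +
        (if j < i then symOf N x j i ^ 2 else 0)) := by
    intro i j
    rw [symOf_comm x j i, ← pow_two]
    rcases lt_trichotomy i j with h | rfl | h
    · simp [h, h.ne, h.not_gt]
    · simp [symOf_self]
    · simp [h, h.ne', h.not_gt]
  simp only [pow_two (symOf N x), trace, diag_apply, mul_apply, hs, sum_add_distrib, sum_ite_eq,
    mem_univ, if_true]
  rw [sum_comm (f := fun i j => if j < i then symOf N x j i ^ 2 else 0), ← hp]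
  ring

lemma prod_offdiag_eq (M : Fin N → Fin N → ℂ) (hM : ∀ i j, M i j = M j i)
    (σ : Equiv.Perm (Fin N)) :
    ∏ i, (if σ i = i then 1 else M i (σ i)) =
      ∏ p : {p : Fin N × Fin N // p.1 < p.2},
        M p.1.1 p.1.2 ^ ((if σ p.1.1 = p.1.2 then 1 else 0) +
          (if σ p.1.2 = p.1.1 then 1 else 0)) := by
  have hp : ∀ f : Fin N → Fin N → ℂ, ∏ p : {p : Fin N × Fin N // p.1 < p.2}, f p.1.1 p.1.2 =
      ∏ i, ∏ j, if i < j then f i j else 1 := by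
    intro f
    rw [← Fintype.prod_prod_type', ← prod_filter,
      ← prod_subtype (univ.filter fun p : Fin N × Fin N => p.1 < p.2) (by simp)
        (fun p => f p.1 p.2)]
  simp only [pow_add, prod_mul_distrib]
  rw [hp fun i j => M i j ^ (if σ i = j then 1 else 0),
    hp fun i j => M i j ^ (if σ j = i then 1 else 0), prod_comm (f := fun i j =>
      if i < j then M i j ^ (if σ j = i then 1 else 0) else 1), ← prod_mul_distrib]
  refine prod_congr rfl fun i _ => ?_
  rw [Fintype.prod_eq_single (σ i) (by intro j hj; simp [hj.symm]),
    Fintype.prod_eq_single (σ i) (by intro j hj; simp [hj.symm])]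
  rcases lt_trichotomy i (σ i) with h | h | h
  · simp [h, h.ne', h.not_gt]
  · simp [← h]
  · simp [h, h.ne, h.not_gt, hM i]

lemma prod_shift_symOf (x : (Fin N → ℝ) × ({p : Fin N × Fin N // p.1 < p.2} → ℝ)) (a : ℂ)
    (σ : Equiv.Perm (Fin N)) :
    ∏ i, (a • (1 : Matrix (Fin N) (Fin N) ℂ) - (symOf N x).map ofReal) i (σ i) =
      (∏ i, if σ i = i then a - x.1 i else 1) *
        ∏ p : {p : Fin N × Fin N // p.1 < p.2},
          (-(x.2 p : ℂ)) ^ ((if σ p.1.1 = p.1.2 then 1 else 0) +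
            (if σ p.1.2 = p.1.1 then 1 else 0)) := by
  have h := prod_offdiag_eq (fun i j => -(symOf N x i j : ℂ))
    (fun i j => by rw [symOf_comm]) σ
  simp only [symOf_of_lt] at h
  rw [← h, ← prod_mul_distrib]
  refine prod_congr rfl fun i _ => ?_
  by_cases hi : σ i = i
  · simp [hi, symOf_self]
  · simp [hi, one_apply_ne (Ne.symm hi)]

end Coordinates

section Correlation
variable {N : ℕ}

lemma integral_goe {g : Matrix (Fin N) (Fin N) ℝ → ℂ} (hg : Measurable g) :
    ∫ H, g H ∂(goe N) = ∫ x : (Fin N → ℝ) × ({p : Fin N × Fin N // p.1 < p.2} → ℝ),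
      (((2 : ℝ) ^ (-(N : ℝ) / 2) * ((N : ℝ) / Real.pi) ^ ((N : ℝ) * (N + 1) / 4) : ℝ) : ℂ) *
        ((∏ i, (Real.exp (-((N : ℝ) / 2) * x.1 i ^ 2) : ℂ)) *
          ∏ p, (Real.exp (-(N : ℝ) * x.2 p ^ 2) : ℂ)) * g (symOf N x) := by
  have hm : Measurable fun x => trace (symOf N x ^ 2) := by
    simp only [trace_symOf_sq]
    fun_prop
  rw [goe, integral_map measurable_symOf.aemeasurable hg.aestronglyMeasurable,
    integral_withDensity_eq_integral_toReal_smul (by fun_prop) (by simp)]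
  refine integral_congr_ae (.of_forall fun x => ?_)
  dsimp only
  rw [ENNReal.toReal_ofReal (by positivity), Complex.real_smul, ← ofReal_prod,
    ← ofReal_prod, ← Real.exp_sum, ← Real.exp_sum, ← ofReal_mul, ← ofReal_mul, ← Real.exp_add,
    ← mul_sum, ← mul_sum, trace_symOf_sq]
  congr 4
  ring

/-- The weighted sum over permutations, with weights `w`, of the products of entries of `a - H`. -/
noncomputable def weightedPerm (w : Equiv.Perm (Fin N) → ℂ) (a : ℂ)
    (H : Matrix (Fin N) (Fin N) ℝ) : ℂ :=
  ∑ σ, w σ * ∏ i, (a • (1 : Matrix (Fin N) (Fin N) ℂ) - H.map ofReal) i (σ i)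

lemma measurable_weightedPerm (w : Equiv.Perm (Fin N) → ℂ) (a : ℂ) :
    Measurable (weightedPerm w a) := by
  have h : ∀ i j, Measurable fun H : Matrix (Fin N) (Fin N) ℝ => H i j := fun i j =>
    (measurable_pi_apply j).comp (measurable_pi_apply i)
  unfold weightedPerm
  simp only [Matrix.sub_apply, Matrix.map_apply]
  fun_prop

lemma integral_weightedPerm_mul (hN : 1 ≤ N) (w w' : Equiv.Perm (Fin N) → ℂ) (a b : ℂ) :
    ∫ H, weightedPerm w a H * weightedPerm w' b H ∂(goe N) =
      ∑ σ, ∑ τ, (w σ * w' τ *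
          ((2 : ℝ) ^ (-(N : ℝ) / 2) * ((N : ℝ) / Real.pi) ^ ((N : ℝ) * (N + 1) / 4) : ℝ)) *
        ((∏ i, ∫ h : ℝ, ((if σ i = i then a - h else 1) * (if τ i = i then b - h else 1)) *
            (Real.exp (-((N : ℝ) / 2) * h ^ 2) : ℂ)) *
          ∏ p : {p : Fin N × Fin N // p.1 < p.2}, ∫ y : ℝ,
            (-(y : ℂ)) ^ edgeCount σ τ p.1.1 p.1.2 * (Real.exp (-(N : ℝ) * y ^ 2) : ℂ)) := by
  have hN0 : (0 : ℝ) < N := by exact_mod_cast hN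
  rw [integral_goe (g := fun H => weightedPerm w a H * weightedPerm w' b H)
    ((measurable_weightedPerm w a).mul (measurable_weightedPerm w' b))]
  set C : ℂ :=
    (((2 : ℝ) ^ (-(N : ℝ) / 2) * ((N : ℝ) / Real.pi) ^ ((N : ℝ) * (N + 1) / 4) : ℝ) : ℂ)
  let D (σ τ : Equiv.Perm (Fin N)) (i : Fin N) (h : ℝ) : ℂ :=
    ((if σ i = i then a - h else 1) * (if τ i = i then b - h else 1)) *
      (Real.exp (-((N : ℝ) / 2) * h ^ 2) : ℂ)
  let O (σ τ : Equiv.Perm (Fin N)) (p : {p : Fin N × Fin N // p.1 < p.2}) (y : ℝ) : ℂ :=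
    (-(y : ℂ)) ^ edgeCount σ τ p.1.1 p.1.2 * (Real.exp (-(N : ℝ) * y ^ 2) : ℂ)
  have hint : ∀ σ τ, Integrable fun x : (Fin N → ℝ) × ({p : Fin N × Fin N // p.1 < p.2} → ℝ) =>
      (w σ * w' τ * C) * ((∏ i, D σ τ i (x.1 i)) * ∏ p, O σ τ p (x.2 p)) := fun σ τ =>
    ((Integrable.fintype_prod fun i => integrable_shift_mul_gaussian (by positivity) a b _ _).mul_prod
      (Integrable.fintype_prod fun p => integrable_pow_mul_gaussian hN0 _)).const_mul _
  calc _ = ∫ x : (Fin N → ℝ) × ({p : Fin N × Fin N // p.1 < p.2} → ℝ), ∑ σ, ∑ τ,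
        (w σ * w' τ * C) * ((∏ i, D σ τ i (x.1 i)) * ∏ p, O σ τ p (x.2 p)) := by
        refine integral_congr_ae (.of_forall fun x => ?_)
        dsimp only
        simp only [weightedPerm, prod_shift_symOf]
        rw [sum_mul_sum]
        simp only [mul_sum, D, O, edgeCount,
          prod_mul_distrib, pow_add]
        refine sum_congr rfl fun σ _ => sum_congr rfl fun τ _ => ?_
        ring
    _ = _ := by
        rw [integral_finsetSum _ fun σ _ => integrable_finsetSum _ fun τ _ => hint σ τ]
        refine sum_congr rfl fun σ _ => ?_
        rw [integral_finsetSum _ fun τ _ => hint σ τ]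
        refine sum_congr rfl fun τ _ => ?_
        rw [integral_const_mul, ← integral_fintype_prod_volume_eq_prod,
          ← integral_fintype_prod_volume_eq_prod, ← integral_prod_mul]
        rfl

lemma perm_eq_weightedPerm (a : ℂ) (H : Matrix (Fin N) (Fin N) ℝ) :
    perm (a • (1 : Matrix (Fin N) (Fin N) ℂ) - H.map ofReal) = weightedPerm 1 a H := by
  simp [perm, weightedPerm]

lemma det_eq_weightedPerm (a : ℂ) (H : Matrix (Fin N) (Fin N) ℝ) :
    det (a • (1 : Matrix (Fin N) (Fin N) ℂ) - H.map ofReal) =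
      weightedPerm (fun σ => ((Equiv.Perm.sign σ : ℤ) : ℂ)) a H := by
  rw [← det_transpose, det_apply']
  rfl

end Correlation

end

/-- The two-point correlation function of GOE permanental polynomials equals the
corresponding correlation function of characteristic polynomials at rotated arguments:
`⟨Per(μ₁·1-H) Per(μ₂·1-H)⟩_GOE = ⟨det(iμ₁·1-H) det(-iμ₂·1-H)⟩_GOE`. -/
theorem goe_two_point_correlation (N : ℕ) (hN : 1 ≤ N) (μ₁ μ₂ : ℂ) :
    (∫ H, perm (μ₁ • (1 : Matrix (Fin N) (Fin N) ℂ) - H.map (Complex.ofReal)) *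
        perm (μ₂ • (1 : Matrix (Fin N) (Fin N) ℂ) - H.map (Complex.ofReal)) ∂(goe N))
      = ∫ H, Matrix.det ((Complex.I * μ₁) • (1 : Matrix (Fin N) (Fin N) ℂ) -
            H.map (Complex.ofReal)) *
          Matrix.det ((-Complex.I * μ₂) • (1 : Matrix (Fin N) (Fin N) ℂ) -
            H.map (Complex.ofReal)) ∂(goe N) := by
  simp only [perm_eq_weightedPerm]
  have hdet := @det_eq_weightedPerm N
  simp only [hdet, integral_weightedPerm_mul hN]
  have hN0 : (0 : ℝ) < N := by exact_mod_cast hN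
  refine sum_congr rfl fun σ _ => sum_congr rfl fun τ _ => ?_
  by_cases h : ∀ p : {p : Fin N × Fin N // p.1 < p.2}, Even (edgeCount σ τ p.1.1 p.1.2)
  · have hσ : fixSign σ τ = 1 := fixSign_eq_one fun i j hij => by
      rcases hij.lt_or_gt with hlt | hlt
      · exact h ⟨(i, j), hlt⟩
      · simpa [edgeCount, add_comm] using h ⟨(j, i), hlt⟩
    simp only [integral_shift_rotate (half_pos hN0)]
    rw [prod_mul_distrib]
    simp only [Pi.one_apply]
    rw [fixSign] at hσ
    have key : ∀ s t F A B C : ℂ, s * t * F = 1 →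
        1 * 1 * C * (A * B) = s * t * C * (F * A * B) := fun s t F A B C hs => by
      linear_combination (-(C * A * B)) * hs
    exact key _ _ _ _ _ _ hσ
  · obtain ⟨p, hp⟩ := not_forall.1 h
    have h0 : ∏ p : {p : Fin N × Fin N // p.1 < p.2}, ∫ y : ℝ,
        (-(y : ℂ)) ^ edgeCount σ τ p.1.1 p.1.2 * (Real.exp (-(N : ℝ) * y ^ 2) : ℂ) = 0 :=
      prod_eq_zero (mem_univ p) (integral_odd_pow_mul_gaussian (N : ℝ) hp)
    simp only [h0, mul_zero]
end
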